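/- Let P be a polynomial with complex coefficients of degree n, let Q(z) = z^n · conj(P(1/conj(z))) be its conjugate-reciprocal polynomial, let a be a complex number with |a| ≤ 1, and let β be a complex number with |β| ≤ 1. Then for every real R ≥ 1 and every complex z with |z| ≥ 1, |S̃_a[P](Rz) + β·((R+1)/2)^n·S̃_a[P](z)| + |S̃_a[Q](Rz) + β·((R+1)/2)^n·S̃_a[Q](z)| ≤ [ |R^n + β·((R+1)/2)^n| · n|z|^(n−1) + |1 + β·((R+1)/2)^n| · n|a| ] · max_{|w|=1} |P(w)|. -/

import Mathlib

open Polynomial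

/-- The modified Smirnov operator: S̃ₐ[P](z) = (1+az)·P′(z) − n·a·P(z). -/
noncomputable def smirnov (n : ℕ) (a : ℂ) (P : Polynomial ℂ) (z : ℂ) : ℂ :=
  (1 + a * z) * P.derivative.eval z - (n : ℂ) * a * P.eval z

/-- The maximum of ‖P‖ on the unit circle. -/
noncomputable def maxCircle (P : Polynomial ℂ) : ℝ :=
  sSup {y : ℝ | ∃ w : ℂ, ‖w‖ = 1 ∧ y = ‖P.eval w‖}

/-- The comparison behind the splitting of a multiplier, for a point on the outer circle. -/
lemma norm_add_smul_le_of_outer {A k R s : ℝ} {γ₀ : ℂ} (hR : 1 ≤ R) (hk : 1 < k)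
    (hkA : k ≤ A) (hAk : A ≤ k ^ 2) (h2k : 2 * k ≤ A + 1) (hs : 0 ≤ s) (h₀ : ‖γ₀‖ = k)
    (h₁ : ‖γ₀ + s * (1 + γ₀)‖ = k * ((R + 1) / 2)) :
    ‖(A : ℂ) + γ₀‖ + s * ‖1 + γ₀‖ ≤ ‖(R : ℂ) * A + (γ₀ + s * (1 + γ₀))‖ := by
  obtain ⟨x, y⟩ := γ₀
  have e₀ : x ^ 2 + y ^ 2 = k ^ 2 := by
    rw [← h₀, Complex.sq_norm, Complex.normSq_apply]; ring
  have hs' : s * (k - 1) ≤ k * (R - 1) / 2 := by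
    have h := norm_add_le ((s : ℂ) * (1 + ⟨x, y⟩) + ⟨x, y⟩) (-(s : ℂ))
    have e : (s : ℂ) * (1 + ⟨x, y⟩) + ⟨x, y⟩ + -(s : ℂ) = ((1 + s : ℝ) : ℂ) * ⟨x, y⟩ := by
      push_cast; ring
    rw [e, norm_mul, h₀, norm_neg, Complex.norm_of_nonneg (by linarith),
      Complex.norm_of_nonneg hs, add_comm ((s : ℂ) * _), h₁] at h
    linarith
  have hx : 0 ≤ x + k := by nlinarith [sq_nonneg y]
  set N₁ := ‖(A : ℂ) + ⟨x, y⟩‖ with hN₁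
  set p := ‖(1 : ℂ) + ⟨x, y⟩‖ with hp
  have eN₁ : N₁ ^ 2 = (A - k) ^ 2 + 2 * A * (x + k) := by
    rw [hN₁, Complex.sq_norm, Complex.normSq_apply]; simp; linear_combination e₀
  have ep : p ^ 2 = (k - 1) ^ 2 + 2 * (x + k) := by
    rw [hp, Complex.sq_norm, Complex.normSq_apply]; simp; linear_combination e₀
  have hmul : N₁ * p ≤ (k - 1) * (A - k) + (A + 1) * (x + k) := by
    have hnn : 0 ≤ (k - 1) * (A - k) + (A + 1) * (x + k) := by
      have := mul_nonneg (sub_nonneg.2 hk.le) (sub_nonneg.2 hkA)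
      have := mul_nonneg (by linarith : 0 ≤ A + 1) hx
      linarith
    refine (sq_le_sq₀ (by positivity) hnn).1 ?_
    rw [mul_pow, eN₁, ep]
    have h₁ : 0 ≤ (A - k - (k - 1)) * (A * (k - 1) - (A - k)) := by
      apply mul_nonneg <;> nlinarith
    nlinarith [mul_nonneg hx h₁, mul_nonneg (sq_nonneg (A - 1)) (sq_nonneg (x + k))]
  refine (sq_le_sq₀ (by positivity) (norm_nonneg _)).1 ?_
  have e : ‖(R : ℂ) * A + (⟨x, y⟩ + s * (1 + ⟨x, y⟩))‖ ^ 2 = N₁ ^ 2 + s ^ 2 * p ^ 2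
      + (R - 1) * A * ((R - 1) * A + 2 * (A + x))
      + 2 * s * (R * A + k ^ 2 + (R * A + 1) * x) := by
    rw [eN₁, ep, Complex.sq_norm, Complex.normSq_apply]; simp
    linear_combination (1 + 2 * s + s ^ 2) * e₀
  rw [e]
  have hE : 0 ≤ (R + 1) * A - 2 * k := by nlinarith
  have h₂ : 2 * s * (k - 1) * ((R + 1) * A - 2 * k) ≤ (R - 1) * A * ((R + 1) * A - 2 * k) := by
    apply mul_le_mul_of_nonneg_right _ hE
    nlinarith
  have h₃ : 0 ≤ (R - 1) * A * (x + k) := by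
    apply mul_nonneg (mul_nonneg _ _) hx <;> linarith
  have h₄ := mul_le_mul_of_nonneg_left hmul hs
  have h₅ : 0 ≤ s * ((R - 1) * A * (x + k)) := mul_nonneg hs h₃
  nlinarith

/-- Adding a larger real number to a multiplier increases its modulus. -/
lemma norm_ofReal_add_le_norm_ofReal_add {A B : ℝ} {γ : ℂ} (hAB : A ≤ B)
    (h : 2 * ‖γ‖ ≤ A + B) : ‖(A : ℂ) + γ‖ ≤ ‖(B : ℂ) + γ‖ := by
  refine (sq_le_sq₀ (by positivity) (norm_nonneg _)).1 ?_
  rw [Complex.sq_norm, Complex.sq_norm, Complex.normSq_apply, Complex.normSq_apply]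
  have := (abs_le.1 (Complex.abs_re_le_norm γ)).1
  simp
  nlinarith

lemma exists_multiplier_split_of_lt {A k R : ℝ} {γ : ℂ} (hR : 1 ≤ R) (hk : 1 < k)
    (hkA : k ≤ A) (hAk : A ≤ k ^ 2) (h2k : 2 * k ≤ A + 1) (hkγ : k < ‖γ‖)
    (hγ : ‖γ‖ ≤ k * ((R + 1) / 2)) :
    ∃ γ₀ : ℂ, ‖γ₀‖ ≤ k ∧ ‖1 + γ₀‖ + ‖γ - γ₀‖ ≤ ‖1 + γ‖ ∧
      ‖(A : ℂ) + γ₀‖ + ‖γ - γ₀‖ ≤ ‖(R : ℂ) * A + γ‖ := by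
  set f : ℝ → ℝ := fun t => ‖-1 + (t : ℂ) * (1 + γ)‖ with hf
  have hfc : Continuous f := by fun_prop
  have f0 : f 0 = 1 := by simp [hf]
  have f1 : f 1 = ‖γ‖ := by simp [hf]
  have hpos : 0 < ‖1 + γ‖ := by
    have := norm_sub_norm_le γ (-1)
    rw [norm_neg, norm_one, sub_neg_eq_add, add_comm γ] at this
    linarith
  obtain ⟨t, ⟨ht0, ht1⟩, ht⟩ := intermediate_value_Icc zero_le_one hfc.continuousOn
    (show k ∈ Set.Icc (f 0) (f 1) from ⟨by linarith, by linarith⟩)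
  set L := 1 + (k * ((R + 1) / 2) + 1) / ‖1 + γ‖ with hL
  have hL1 : 1 ≤ L := by
    rw [hL]
    have : 0 ≤ (k * ((R + 1) / 2) + 1) / ‖1 + γ‖ := by positivity
    linarith
  have hfL : k * ((R + 1) / 2) ≤ f L := by
    have h := norm_sub_norm_le ((L : ℂ) * (1 + γ)) 1
    rw [norm_mul, norm_one, Complex.norm_of_nonneg (by linarith)] at h
    have e : L * ‖1 + γ‖ = ‖1 + γ‖ + (k * ((R + 1) / 2) + 1) := by
      rw [hL]; field_simp
    have : f L = ‖(L : ℂ) * (1 + γ) - 1‖ := by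
      simp only [hf]; congr 1; ring
    linarith
  obtain ⟨u, ⟨hu0, -⟩, hu⟩ := intermediate_value_Icc hL1 hfc.continuousOn
    (show k * ((R + 1) / 2) ∈ Set.Icc (f 1) (f L) from ⟨by linarith, hfL⟩)
  have htpos : 0 < t := by
    rcases ht0.eq_or_lt with rfl | h
    · linarith
    · exact h
  have htC : (t : ℂ) ≠ 0 := by exact_mod_cast htpos.ne'
  set γ₀ : ℂ := -1 + (t : ℂ) * (1 + γ) with hγ₀
  have e₁ : 1 + γ₀ = t * (1 + γ) := by rw [hγ₀]; ring
  have e₂ : γ - γ₀ = ((1 - t : ℝ) : ℂ) * (1 + γ) := by rw [hγ₀]; push_cast; ring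
  have n₁ : ‖1 + γ₀‖ = t * ‖1 + γ‖ := by
    rw [e₁, norm_mul, Complex.norm_of_nonneg ht0]
  have n₂ : ‖γ - γ₀‖ = (1 - t) * ‖1 + γ‖ := by
    rw [e₂, norm_mul, Complex.norm_of_nonneg (by linarith)]
  have e₃ : γ₀ + ((u - t) / t : ℝ) * (1 + γ₀) = -1 + (u : ℂ) * (1 + γ) := by
    rw [e₁, hγ₀]; push_cast; field_simp; ring
  have h := norm_add_smul_le_of_outer (A := A) (γ₀ := γ₀) (s := (u - t) / t) hR hk hkA hAk h2k
    (div_nonneg (by linarith) ht0) ht (by rw [e₃]; exact hu)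
  rw [e₃, n₁] at h
  have e₄ : (u - t) / t * (t * ‖1 + γ‖) = (u - t) * ‖1 + γ‖ := by field_simp
  have e₅ : (R : ℂ) * A + (-1 + (u : ℂ) * (1 + γ))
      = (R * A + γ) + ((u - 1 : ℝ) : ℂ) * (1 + γ) := by push_cast; ring
  have h' := norm_add_le ((R : ℂ) * A + γ) (((u - 1 : ℝ) : ℂ) * (1 + γ))
  rw [norm_mul, Complex.norm_of_nonneg (by linarith : 0 ≤ u - 1)] at h'
  rw [e₄, e₅] at h
  refine ⟨γ₀, ht.le, by rw [n₁, n₂]; linarith, ?_⟩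
  rw [n₂]
  linarith

/-- A multiplier of modulus at most `((R + 1) / 2) ^ (m + 1)` is moved to one of modulus at most
`((R + 1) / 2) ^ m`, at a cost controlled by `‖1 + γ‖` and `‖R ^ (m + 1) + γ‖`. -/
lemma exists_multiplier_split (m : ℕ) {R : ℝ} {γ : ℂ} (hR : 1 ≤ R)
    (hγ : ‖γ‖ ≤ ((R + 1) / 2) ^ (m + 1)) :
    ∃ γ₀ : ℂ, ‖γ₀‖ ≤ ((R + 1) / 2) ^ m ∧ ‖1 + γ₀‖ + ‖γ - γ₀‖ ≤ ‖1 + γ‖ ∧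
      ‖(R : ℂ) ^ m + γ₀‖ + ‖γ - γ₀‖ ≤ ‖(R : ℂ) ^ (m + 1) + γ‖ := by
  have hk1 : 1 ≤ ((R + 1) / 2) ^ m := one_le_pow₀ (by linarith)
  have hkA : ((R + 1) / 2) ^ m ≤ R ^ m := by gcongr; linarith
  have hARA : R ^ m ≤ R ^ (m + 1) := pow_le_pow_right₀ hR (by omega)
  rcases le_or_gt ‖γ‖ (((R + 1) / 2) ^ m) with h | h
  · refine ⟨γ, h, by simp, ?_⟩
    have := norm_ofReal_add_le_norm_ofReal_add (γ := γ) hARA (by linarith)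
    simpa using this
  have hR' : 1 < R := by
    rcases hR.eq_or_lt with rfl | hR'
    · norm_num at h hγ; linarith
    · exact hR'
  rcases Nat.eq_zero_or_pos m with rfl | hm
  · refine ⟨-1, by simp, by simp [add_comm], ?_⟩
    have := norm_ofReal_add_le_norm_ofReal_add (γ := γ) hR (by simp at hγ; linarith)
    simpa [add_comm] using this
  have h2k : 2 * ((R + 1) / 2) ^ m ≤ R ^ m + 1 := by
    have := add_pow_le (by linarith : 0 ≤ R) zero_le_one m
    obtain ⟨j, rfl⟩ : ∃ j, m = j + 1 := ⟨m - 1, by omega⟩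
    simp only [one_pow, Nat.add_sub_cancel] at this
    rw [div_pow, pow_succ 2 j]
    field_simp
    linarith
  have hAk : R ^ m ≤ (((R + 1) / 2) ^ m) ^ 2 := by
    rw [← pow_mul, mul_comm, pow_mul]
    gcongr
    nlinarith [sq_nonneg (R - 1)]
  obtain ⟨γ₀, h₁, h₂, h₃⟩ := exists_multiplier_split_of_lt hR
    (one_lt_pow₀ (by linarith) hm.ne') hkA hAk h2k h (by rwa [pow_succ] at hγ)
  refine ⟨γ₀, h₁, h₂, ?_⟩
  rw [pow_succ']
  exact_mod_cast h₃

lemma norm_eval_le_maxCircle (P : ℂ[X]) {w : ℂ} (hw : ‖w‖ = 1) :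
    ‖P.eval w‖ ≤ maxCircle P := by
  have hK : IsCompact ((fun w => ‖P.eval w‖) '' Metric.sphere (0 : ℂ) 1) :=
    (isCompact_sphere 0 1).image (by fun_prop)
  refine le_csSup (hK.bddAbove.mono ?_) ⟨w, hw, rfl⟩
  rintro _ ⟨v, hv, rfl⟩
  exact ⟨v, by simpa using hv, rfl⟩

lemma norm_eval_le_maxCircle_of_norm_le (P : ℂ[X]) {w : ℂ} (hw : ‖w‖ ≤ 1) :
    ‖P.eval w‖ ≤ maxCircle P := by
  refine Complex.norm_le_of_forall_mem_frontier_norm_le (U := Metric.ball 0 1)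
    Metric.isBounded_ball (f := fun w => P.eval w) P.differentiable.diffContOnCl ?_
    (by rw [closure_ball _ one_ne_zero]; simpa using hw)
  intro v hv
  rw [frontier_ball _ one_ne_zero] at hv
  exact norm_eval_le_maxCircle P (by simpa using hv)

lemma norm_eval_eq_prod (P : ℂ[X]) (x : ℂ) :
    ‖P.eval x‖ = ‖P.leadingCoeff‖ * (P.roots.map fun ζ => ‖x - ζ‖).prod := by
  have h := map_multiset_prod (normHom : ℂ →*₀ ℝ) (P.roots.map (x - ·))
  rw [Multiset.map_map] at h
  rw [(IsAlgClosed.splits P).eval_eq_prod_roots, norm_mul]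
  exact congrArg _ h

lemma pow_natDegree_mul_norm_eval_le (P : ℂ[X]) {c : ℝ} (hc : 0 ≤ c) {x y : ℂ}
    (h : ∀ ζ ∈ P.roots, c * ‖x - ζ‖ ≤ ‖y - ζ‖) :
    c ^ P.natDegree * ‖P.eval x‖ ≤ ‖P.eval y‖ := by
  rw [norm_eval_eq_prod, norm_eval_eq_prod, (IsAlgClosed.splits P).natDegree_eq_card_roots,
    mul_left_comm]
  gcongr
  calc c ^ P.roots.card * (P.roots.map fun ζ => ‖x - ζ‖).prod
      = (P.roots.map fun ζ => c * ‖x - ζ‖).prod := by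
        rw [Multiset.prod_map_mul, Multiset.map_const', Multiset.prod_replicate]
    _ ≤ _ := Multiset.prod_map_le_prod_map₀ _ _ (fun _ _ => by positivity) h

lemma half_add_one_mul_norm_sub_le {R : ℝ} (hR : 1 ≤ R) {z ζ : ℂ} (hz : 1 ≤ ‖z‖)
    (hζ : ‖ζ‖ ≤ 1) : (R + 1) / 2 * ‖z - ζ‖ ≤ ‖(R : ℂ) * z - ζ‖ := by
  have e : (R : ℂ) * z - ζ = (((R + 1) / 2 : ℝ) : ℂ) * (z - ζ)
      + (((R - 1) / 2 : ℝ) : ℂ) * (z + ζ) := by push_cast; ring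
  refine (sq_le_sq₀ (by positivity) (norm_nonneg _)).1 ?_
  rw [mul_pow, Complex.sq_norm, Complex.sq_norm, Complex.normSq_apply, Complex.normSq_apply]
  have h₁ : 1 ≤ z.re ^ 2 + z.im ^ 2 := by
    have : 1 ≤ ‖z‖ ^ 2 := by nlinarith
    rw [Complex.sq_norm, Complex.normSq_apply] at this
    linarith
  have h₂ : ζ.re ^ 2 + ζ.im ^ 2 ≤ 1 := by
    have : ‖ζ‖ ^ 2 ≤ 1 := by nlinarith [norm_nonneg ζ]
    rw [Complex.sq_norm, Complex.normSq_apply] at this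
    linarith
  simp
  have h₃ : 0 ≤ (R - 1) ^ 2 * ((z.re + ζ.re) ^ 2 + (z.im + ζ.im) ^ 2) := by positivity
  have h₄ : 0 ≤ (R - 1) * (R + 1) * ((z.re ^ 2 + z.im ^ 2) - (ζ.re ^ 2 + ζ.im ^ 2)) := by
    apply mul_nonneg (mul_nonneg _ _) <;> linarith
  nlinarith

/-- The Smirnov operator as a linear map on polynomials. -/
noncomputable def smirnovPoly (n : ℕ) (a : ℂ) : ℂ[X] →ₗ[ℂ] ℂ[X] :=
  LinearMap.mulLeft ℂ (1 + C a * X) ∘ₗ derivative - (n * a : ℂ) • LinearMap.id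

lemma smirnovPoly_apply (n : ℕ) (a : ℂ) (P : ℂ[X]) :
    smirnovPoly n a P = (1 + C a * X) * derivative P - C (n * a : ℂ) * P := by
  simp [smirnovPoly, smul_eq_C_mul]

lemma eval_smirnovPoly (n : ℕ) (a : ℂ) (P : ℂ[X]) (z : ℂ) :
    (smirnovPoly n a P).eval z = smirnov n a P z := by
  simp [smirnovPoly_apply, smirnov]

lemma re_smirnov_factor_pos {a z ζ : ℂ} (ha : ‖a‖ ≤ 1) (hz : 1 ≤ ‖z‖) (hζ : ‖ζ‖ < 1)
    (haz : 1 + a * z ≠ 0) :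
    0 < ((1 + a * ζ) / (z - ζ) * (z + (starRingEnd ℂ) a)).re := by
  have hne : z - ζ ≠ 0 := fun h => by rw [sub_eq_zero.1 h] at hz; linarith
  have hpos := Complex.normSq_pos.2 hne
  have h₁ : 0 < Complex.normSq (1 + a * z) := Complex.normSq_pos.2 haz
  have ha' : Complex.normSq a ≤ 1 := by
    rw [Complex.normSq_eq_norm_sq]; nlinarith [norm_nonneg a]
  have hz' : 1 ≤ Complex.normSq z := by
    rw [Complex.normSq_eq_norm_sq]; nlinarith
  have hζ' : Complex.normSq ζ < 1 := by
    rw [Complex.normSq_eq_norm_sq]; nlinarith [norm_nonneg ζ]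
  have e : (1 + a * ζ) / (z - ζ) * (z + (starRingEnd ℂ) a)
      = ((1 + a * ζ) * (z + (starRingEnd ℂ) a) * (starRingEnd ℂ) (z - ζ))
        * (((Complex.normSq (z - ζ))⁻¹ : ℝ) : ℂ) := by
    rw [div_eq_mul_inv, Complex.inv_def]; ring
  rw [e, Complex.re_mul_ofReal]
  refine mul_pos ?_ (inv_pos.2 hpos)
  have key : 2 * ((1 + a * ζ) * (z + (starRingEnd ℂ) a) * (starRingEnd ℂ) (z - ζ)).re
      = Complex.normSq (1 + a * ζ) * (Complex.normSq z - 1)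
        + (1 - Complex.normSq a) * Complex.normSq (z - ζ)
        + (1 - Complex.normSq ζ) * Complex.normSq (1 + a * z) := by
    simp [Complex.normSq_apply]; ring
  have t₁ : 0 ≤ Complex.normSq (1 + a * ζ) * (Complex.normSq z - 1) :=
    mul_nonneg (Complex.normSq_nonneg _) (by linarith)
  have t₂ : 0 ≤ (1 - Complex.normSq a) * Complex.normSq (z - ζ) :=
    mul_nonneg (by linarith) hpos.le
  have t₃ : 0 < (1 - Complex.normSq ζ) * Complex.normSq (1 + a * z) :=
    mul_pos (by linarith) h₁
  linarith

/-- Laguerre's theorem for the Smirnov operator. -/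
lemma smirnov_ne_zero {n : ℕ} (hn : n ≠ 0) {a z : ℂ} (ha : ‖a‖ ≤ 1) (hz : 1 ≤ ‖z‖) {W : ℂ[X]}
    (hW : W.natDegree = n) (hroots : ∀ w : ℂ, 1 ≤ ‖w‖ → W.eval w ≠ 0) :
    smirnov n a W z ≠ 0 := by
  have hWz := hroots z hz
  by_cases haz : 1 + a * z = 0
  · have ha0 : a ≠ 0 := by rintro rfl; simp at haz
    simp [smirnov, haz, hn, ha0, hWz]
  have hcard : W.roots.card = n := by
    rw [← (IsAlgClosed.splits W).natDegree_eq_card_roots, hW]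
  have hlt : ∀ ζ ∈ W.roots, ‖ζ‖ < 1 := fun ζ hζ => by
    by_contra! h
    exact hroots ζ h (isRoot_of_mem_roots hζ)
  have e : smirnov n a W z = W.eval z * (W.roots.map fun ζ => (1 + a * ζ) / (z - ζ)).sum := by
    have h₁ : (W.roots.map fun ζ => (1 + a * ζ) / (z - ζ)).sum
        = (W.roots.map fun ζ => (1 + a * z) * (1 / (z - ζ)) - a).sum := by
      congr 1
      refine Multiset.map_congr rfl fun ζ hζ => ?_
      have : z - ζ ≠ 0 := fun h => by
        have := hlt ζ hζ
        rw [← sub_eq_zero.1 h] at this; linarith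
      field_simp
      ring
    rw [h₁, Multiset.sum_map_sub, Multiset.sum_map_mul_left, Multiset.map_const',
      Multiset.sum_replicate, hcard, smirnov,
      (IsAlgClosed.splits W).eval_derivative_eq_eval_mul_sum hWz, nsmul_eq_mul]
    ring
  rw [e]
  refine mul_ne_zero hWz fun h0 => ?_
  have h : (0 : ℝ) < (W.roots.map fun ζ =>
      ((1 + a * ζ) / (z - ζ) * (z + (starRingEnd ℂ) a)).re).sum := by
    have hne : W.roots ≠ 0 := fun h => hn (by rw [← hcard, h]; rfl)
    have := Multiset.sum_lt_sum_of_nonempty (s := W.roots) (f := fun _ => (0 : ℝ)) hne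
      fun ζ hζ => re_smirnov_factor_pos ha hz (hlt ζ hζ) haz
    simpa using this
  have h' : (W.roots.map fun ζ =>
      ((1 + a * ζ) / (z - ζ) * (z + (starRingEnd ℂ) a)).re).sum
      = ((W.roots.map fun ζ => (1 + a * ζ) / (z - ζ)).sum * (z + (starRingEnd ℂ) a)).re := by
    rw [← Multiset.sum_map_mul_right]
    change _ = Complex.reAddGroupHom _
    rw [map_multiset_sum, Multiset.map_map]
    rfl
  rw [h', h0] at h
  simp at h

lemma natDegree_smirnovPoly {n : ℕ} (hn : n ≠ 0) {a : ℂ} (ha : ‖a‖ ≤ 1) {W : ℂ[X]}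
    (hW : W.natDegree = n) (hroots : ∀ w : ℂ, 1 ≤ ‖w‖ → W.eval w ≠ 0) :
    (smirnovPoly n a W).natDegree = n - 1 := by
  obtain ⟨m, rfl⟩ : ∃ m, n = m + 1 := ⟨n - 1, by omega⟩
  have hcoeff : ∀ k, (smirnovPoly (m + 1) a W).coeff k
      = W.coeff (k + 1) * (k + 1) + a * (k - (m + 1)) * W.coeff k := by
    intro k
    rw [smirnovPoly_apply, add_mul, one_mul, mul_assoc, coeff_sub, coeff_add, coeff_C_mul,
      coeff_C_mul, coeff_derivative]
    cases k with
    | zero => simp; ring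
    | succ k => rw [coeff_X_mul, coeff_derivative]; push_cast; ring
  have hsplit := IsAlgClosed.splits W
  have hcard : W.roots.card = m + 1 := by rw [← hsplit.natDegree_eq_card_roots, hW]
  have hlt : ∀ ζ ∈ W.roots, ‖ζ‖ < 1 := fun ζ hζ => by
    by_contra! h
    exact hroots ζ h (isRoot_of_mem_roots hζ)
  have hsum : ‖W.roots.sum‖ < m + 1 := by
    calc ‖W.roots.sum‖ ≤ (W.roots.map fun ζ => ‖ζ‖).sum := norm_multiset_sum_le _
      _ < (W.roots.map fun _ => (1 : ℝ)).sum :=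
        Multiset.sum_lt_sum_of_nonempty (fun h => by rw [h] at hcard; simp at hcard) hlt
      _ = m + 1 := by simp [hcard, add_comm]
  have hlead : W.leadingCoeff ≠ 0 :=
    leadingCoeff_ne_zero.2 fun h => hroots 1 (by simp) (by simp [h])
  have hnext : W.coeff m = -W.leadingCoeff * W.roots.sum := by
    rw [← hsplit.nextCoeff_eq_neg_sum_roots_mul_leadingCoeff,
      nextCoeff_of_natDegree_pos (by omega), hW, Nat.add_sub_cancel]
  have htop : W.coeff (m + 1) = W.leadingCoeff := by rw [leadingCoeff, hW]
  refine natDegree_eq_of_le_of_coeff_ne_zero ?_ ?_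
  · rw [natDegree_le_iff_coeff_eq_zero]
    intro k hk
    rw [Nat.add_sub_cancel] at hk
    rw [hcoeff, coeff_eq_zero_of_natDegree_lt (by omega)]
    rcases (Nat.succ_le_of_lt hk).eq_or_lt with rfl | hk
    · push_cast; ring
    · rw [coeff_eq_zero_of_natDegree_lt (by omega)]; ring
  · rw [Nat.add_sub_cancel, hcoeff, htop, hnext]
    have e : W.leadingCoeff * (m + 1) + a * (m - (m + 1)) * (-W.leadingCoeff * W.roots.sum)
        = W.leadingCoeff * ((m + 1 : ℕ) + a * W.roots.sum) := by push_cast; ring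
    rw [e]
    refine mul_ne_zero hlead fun h => ?_
    have h₁ : ‖a * W.roots.sum‖ = m + 1 := by
      rw [← neg_eq_of_add_eq_zero_right h, norm_neg, Complex.norm_natCast]; simp
    rw [norm_mul] at h₁
    nlinarith [norm_nonneg W.roots.sum]

lemma half_add_one_pow_mul_norm_smirnov_le {n : ℕ} (hn : n ≠ 0) {a z : ℂ} (ha : ‖a‖ ≤ 1)
    (hz : 1 ≤ ‖z‖) {R : ℝ} (hR : 1 ≤ R) {W : ℂ[X]} (hW : W.natDegree = n)
    (hroots : ∀ w : ℂ, 1 ≤ ‖w‖ → W.eval w ≠ 0) :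
    ((R + 1) / 2) ^ (n - 1) * ‖smirnov n a W z‖ ≤ ‖smirnov n a W (R * z)‖ := by
  rw [← eval_smirnovPoly, ← eval_smirnovPoly, ← natDegree_smirnovPoly hn ha hW hroots]
  refine pow_natDegree_mul_norm_eval_le _ (by linarith) fun ζ hζ =>
    half_add_one_mul_norm_sub_le hR hz ?_
  by_contra! h
  refine smirnov_ne_zero hn ha h.le hW hroots ?_
  rw [← eval_smirnovPoly]
  exact isRoot_of_mem_roots hζ

lemma eval_sum_conj_coeff {n : ℕ} {P : ℂ[X]} (hP : P.natDegree = n) {z : ℂ} (hz : z ≠ 0) :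
    (∑ k ∈ Finset.range (n + 1), C ((starRingEnd ℂ) (P.coeff (n - k))) * X ^ k).eval z
      = z ^ n * (starRingEnd ℂ) (P.eval ((starRingEnd ℂ) z)⁻¹) := by
  rw [eval_finsetSum, eval_eq_sum_range, hP, map_sum, Finset.mul_sum, ← Finset.sum_flip]
  refine Finset.sum_congr rfl fun k hk => ?_
  have hk' : k ≤ n := by simpa [Nat.lt_succ_iff] using hk
  have e : z ^ n = z ^ (n - k) * z ^ k := by rw [← pow_add, Nat.sub_add_cancel hk']
  simp only [eval_mul, eval_C, eval_pow, eval_X, map_mul, map_pow, map_inv₀, Complex.conj_conj,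
    Nat.sub_sub_self hk', e, inv_pow]
  field_simp

lemma norm_sub_le_norm_one_sub_conj_mul {z ζ : ℂ} (hz : 1 ≤ ‖z‖) (hζ : 1 ≤ ‖ζ‖) :
    ‖z - ζ‖ ≤ ‖1 - (starRingEnd ℂ) z * ζ‖ := by
  refine (sq_le_sq₀ (norm_nonneg _) (norm_nonneg _)).1 ?_
  have key : ‖1 - (starRingEnd ℂ) z * ζ‖ ^ 2 - ‖z - ζ‖ ^ 2
      = (‖z‖ ^ 2 - 1) * (‖ζ‖ ^ 2 - 1) := by
    simp only [Complex.sq_norm, Complex.normSq_apply]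
    simp
    ring
  have : 0 ≤ (‖z‖ ^ 2 - 1) * (‖ζ‖ ^ 2 - 1) := mul_nonneg (by nlinarith) (by nlinarith)
  linarith

lemma norm_eval_le_norm_eval_reciprocal {n : ℕ} {U : ℂ[X]} (hU : U.natDegree = n)
    (hroots : ∀ ζ ∈ U.roots, 1 ≤ ‖ζ‖) {z : ℂ} (hz : 1 ≤ ‖z‖) :
    ‖U.eval z‖ ≤ ‖z ^ n * (starRingEnd ℂ) (U.eval ((starRingEnd ℂ) z)⁻¹)‖ := by
  have hz0 : 0 < ‖z‖ := by linarith
  have hz0' : (starRingEnd ℂ) z ≠ 0 := by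
    rw [Ne, map_eq_zero]; exact norm_pos_iff.1 hz0
  have h := pow_natDegree_mul_norm_eval_le U (inv_nonneg.2 hz0.le) (x := z)
    (y := ((starRingEnd ℂ) z)⁻¹) fun ζ hζ => by
      have e : ((starRingEnd ℂ) z)⁻¹ - ζ
          = ((starRingEnd ℂ) z)⁻¹ * (1 - (starRingEnd ℂ) z * ζ) := by field_simp
      rw [e, norm_mul, norm_inv, Complex.norm_conj]
      exact mul_le_mul_of_nonneg_left (norm_sub_le_norm_one_sub_conj_mul hz (hroots ζ hζ))
        (by positivity)
  rw [hU, inv_pow, inv_mul_le_iff₀ (by positivity)] at h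
  rwa [norm_mul, norm_pow, Complex.norm_conj]

lemma norm_leadingCoeff_le_norm_eval_zero {U : ℂ[X]} (hroots : ∀ ζ ∈ U.roots, 1 ≤ ‖ζ‖) :
    ‖U.leadingCoeff‖ ≤ ‖U.eval 0‖ := by
  rw [norm_eval_eq_prod]
  refine le_mul_of_one_le_right (norm_nonneg _) ?_
  calc (1 : ℝ) = (U.roots.map fun _ => (1 : ℝ)).prod := by simp
    _ ≤ _ := Multiset.prod_map_le_prod_map₀ _ _ (fun _ _ => zero_le_one)
      fun ζ hζ => by simpa using hroots ζ hζ

/-- A functional that does not vanish on polynomials of degree `n` with all zeros in the open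
unit disc respects the domination between `P - C l` and its reciprocal, once `l` exceeds the
maximum modulus of `P`. -/
lemma norm_map_sub_le_norm_map_reciprocal_sub {n : ℕ} {F : ℂ[X] →ₗ[ℂ] ℂ}
    (hF : ∀ W : ℂ[X], W.natDegree = n → (∀ w : ℂ, 1 ≤ ‖w‖ → W.eval w ≠ 0) → F W ≠ 0)
    {P Q : ℂ[X]} (hP : P.natDegree = n)
    (hQ : Q = ∑ k ∈ Finset.range (n + 1), C ((starRingEnd ℂ) (P.coeff (n - k))) * X ^ k)
    {l : ℂ} (hl : maxCircle P < ‖l‖) :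
    F (Q - C ((starRingEnd ℂ) l) * X ^ n) ≠ 0 ∧
      ‖F (P - C l)‖ ≤ ‖F (Q - C ((starRingEnd ℂ) l) * X ^ n)‖ := by
  set U := P - C l with hU
  set V := Q - C ((starRingEnd ℂ) l) * X ^ n with hV
  have hUdeg : U.natDegree = n := by rw [hU, natDegree_sub_C, hP]
  have hUdisc : ∀ w : ℂ, ‖w‖ ≤ 1 → U.eval w ≠ 0 := fun w hw h => by
    have h' := norm_eval_le_maxCircle_of_norm_le P hw
    rw [hU, eval_sub, eval_C, sub_eq_zero] at h
    rw [h] at h'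
    linarith
  have hUroots : ∀ ζ ∈ U.roots, 1 ≤ ‖ζ‖ := fun ζ hζ => by
    by_contra! h
    exact hUdisc ζ h.le (isRoot_of_mem_roots hζ)
  have hVeval : ∀ z : ℂ, z ≠ 0 →
      V.eval z = z ^ n * (starRingEnd ℂ) (U.eval ((starRingEnd ℂ) z)⁻¹) := fun z hz => by
    rw [hV, hU, eval_sub, hQ, eval_sum_conj_coeff hP hz]
    simp
    ring
  have hle : ∀ z : ℂ, 1 ≤ ‖z‖ → ‖U.eval z‖ ≤ ‖V.eval z‖ := fun z hz => by
    rw [hVeval z (norm_pos_iff.1 (by linarith))]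
    exact norm_eval_le_norm_eval_reciprocal hUdeg hUroots hz
  have hVne : ∀ z : ℂ, 1 ≤ ‖z‖ → V.eval z ≠ 0 := fun z hz => by
    have hz0 : z ≠ 0 := norm_pos_iff.1 (by linarith)
    rw [hVeval z hz0]
    refine mul_ne_zero (pow_ne_zero _ hz0) ?_
    rw [Ne, map_eq_zero]
    refine hUdisc _ ?_
    rw [norm_inv, Complex.norm_conj]
    exact inv_le_one_of_one_le₀ hz
  have hVcoeff : V.coeff n = (starRingEnd ℂ) (U.eval 0) := by
    rw [hV, hU, hQ]
    simp [coeff_C_mul, coeff_X_pow, coeff_zero_eq_eval_zero]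
  have hVdeg : V.natDegree ≤ n := by
    refine (natDegree_sub_le_of_le ?_ (natDegree_C_mul_X_pow_le _ _)).trans (max_self n).le
    rw [hQ]
    exact natDegree_sum_le_of_forall_le _ _ fun k hk =>
      (natDegree_C_mul_X_pow_le _ _).trans (by simpa [Nat.lt_succ_iff] using hk)
  have hlead : ‖U.coeff n‖ ≤ ‖V.coeff n‖ := by
    have := norm_leadingCoeff_le_norm_eval_zero hUroots
    rwa [leadingCoeff, hUdeg, ← Complex.norm_conj (U.eval 0), ← hVcoeff] at this
  have hlt : ∀ {u x y : ℂ}, ‖u‖ < 1 → ‖x‖ ≤ ‖y‖ → y ≠ 0 → y + u * x ≠ 0 := by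
    intro u x y hu hxy hy h
    have h₁ : ‖y‖ = ‖u‖ * ‖x‖ := by rw [eq_neg_of_add_eq_zero_left h, norm_neg, norm_mul]
    have := norm_pos_iff.2 hy
    nlinarith [norm_nonneg u]
  have hVn : V.coeff n ≠ 0 := by
    rw [hVcoeff, Ne, map_eq_zero]
    exact hUdisc 0 (by simp)
  have hcomb : ∀ u : ℂ, ‖u‖ < 1 → F V + u * F U ≠ 0 := fun u hu => by
    have := hF (V + C u * U) ?_ fun w hw => ?_
    · rwa [map_add, ← smul_eq_C_mul, map_smul, smul_eq_mul] at this
    · refine natDegree_eq_of_le_of_coeff_ne_zero ?_ ?_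
      · exact natDegree_add_le_of_degree_le hVdeg ((natDegree_C_mul_le _ _).trans hUdeg.le)
      · rw [coeff_add, coeff_C_mul]
        exact hlt hu hlead hVn
    · rw [eval_add, eval_mul, eval_C]
      exact hlt hu (hle w hw) (hVne w hw)
  refine ⟨by simpa using hcomb 0 (by simp), ?_⟩
  by_contra! h
  have hFU : 0 < ‖F U‖ := (norm_nonneg _).trans_lt h
  refine hcomb (-(F V / F U)) ?_ ?_
  · rwa [norm_neg, norm_div, div_lt_one hFU]
  · rw [neg_mul, div_mul_cancel₀ _ (norm_pos_iff.1 hFU), add_neg_cancel]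

/-- The sum estimate for a polynomial and its reciprocal under a zero-preserving functional. -/
lemma norm_map_add_norm_map_reciprocal_le {n : ℕ} {F : ℂ[X] →ₗ[ℂ] ℂ}
    (hF : ∀ W : ℂ[X], W.natDegree = n → (∀ w : ℂ, 1 ≤ ‖w‖ → W.eval w ≠ 0) → F W ≠ 0)
    {P Q : ℂ[X]} (hP : P.natDegree = n)
    (hQ : Q = ∑ k ∈ Finset.range (n + 1), C ((starRingEnd ℂ) (P.coeff (n - k))) * X ^ k) :
    ‖F P‖ + ‖F Q‖ ≤ (‖F (X ^ n)‖ + ‖F 1‖) * maxCircle P := by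
  have hX : F (X ^ n) ≠ 0 := hF _ (natDegree_X_pow n) fun w hw => by
    rw [eval_pow, eval_X]
    exact pow_ne_zero _ (norm_pos_iff.1 (by linarith))
  have hX0 : 0 < ‖F (X ^ n)‖ := norm_pos_iff.2 hX
  have hC : ∀ (l : ℂ) (W : ℂ[X]), F (C l * W) = l * F W := fun l W => by
    rw [← smul_eq_C_mul, map_smul, smul_eq_mul]
  have hM : 0 ≤ maxCircle P := (norm_nonneg _).trans (norm_eval_le_maxCircle P norm_one)
  have hQM : ‖F Q‖ ≤ maxCircle P * ‖F (X ^ n)‖ := by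
    by_contra! h
    refine (norm_map_sub_le_norm_map_reciprocal_sub hF hP hQ
      (l := (starRingEnd ℂ) (F Q / F (X ^ n))) ?_).1 ?_
    · rwa [Complex.norm_conj, norm_div, lt_div_iff₀ hX0]
    · rw [map_sub, hC, Complex.conj_conj, div_mul_cancel₀ _ hX, sub_self]
  have hL : ∀ L : ℝ, maxCircle P < L → ‖F P‖ + ‖F Q‖ ≤ (‖F (X ^ n)‖ + ‖F 1‖) * L := by
    intro L hL
    have hL0 : 0 ≤ L := hM.trans hL.le
    obtain ⟨v, hv, hQv⟩ : ∃ v : ℂ, ‖v‖ = 1 ∧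
        F Q = (‖F Q‖ / ‖F (X ^ n)‖ : ℝ) * (v * F (X ^ n)) := by
      by_cases h0 : F Q = 0
      · exact ⟨1, norm_one, by simp [h0]⟩
      · have h0' : (‖F Q‖ : ℂ) ≠ 0 := by simpa using h0
        have hX' : (‖F (X ^ n)‖ : ℂ) ≠ 0 := by simpa using hX
        refine ⟨F Q / ‖F Q‖ * (‖F (X ^ n)‖ / F (X ^ n)), ?_, ?_⟩
        · simp [norm_ne_zero_iff.2 h0, hX0.ne']
        · push_cast
          field_simp
    have hlv : ‖(starRingEnd ℂ) (L * v)‖ = L := by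
      rw [Complex.norm_conj, norm_mul, hv, mul_one, Complex.norm_of_nonneg hL0]
    have h := (norm_map_sub_le_norm_map_reciprocal_sub hF hP hQ
      (l := (starRingEnd ℂ) (L * v)) (by rwa [hlv])).2
    have e : F (Q - C ((starRingEnd ℂ) ((starRingEnd ℂ) (L * v))) * X ^ n)
        = ((‖F Q‖ / ‖F (X ^ n)‖ - L : ℝ) : ℂ) * (v * F (X ^ n)) := by
      rw [map_sub, hC, Complex.conj_conj]
      push_cast
      push_cast at hQv
      linear_combination hQv
    have hle : ‖F Q‖ / ‖F (X ^ n)‖ ≤ L := by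
      rw [div_le_iff₀ hX0]
      exact hQM.trans (by gcongr)
    have h₁ : ‖F P‖ - L * ‖F 1‖ ≤ ‖F (P - C ((starRingEnd ℂ) (L * v)))‖ := by
      rw [map_sub, ← mul_one (C _), hC]
      have := norm_sub_norm_le (F P) ((starRingEnd ℂ) (L * v) * F 1)
      rwa [norm_mul, hlv] at this
    rw [e, norm_mul, norm_mul, hv, one_mul, Complex.norm_real, Real.norm_of_nonpos (by linarith),
      neg_sub, sub_mul, div_mul_cancel₀ _ hX0.ne'] at h
    linarith
  have hS : 0 < ‖F (X ^ n)‖ + ‖F 1‖ := by positivity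
  rw [← div_le_iff₀' hS]
  exact le_of_forall_gt_imp_ge_of_dense fun L h => (div_le_iff₀' hS).2 (hL L h)

lemma smirnov_X_pow (n : ℕ) (a z : ℂ) : smirnov n a (X ^ n) z = n * z ^ (n - 1) := by
  cases n with
  | zero => simp [smirnov]
  | succ m => simp [smirnov]; ring

lemma smirnov_one (n : ℕ) (a z : ℂ) : smirnov n a 1 z = -(n * a) := by simp [smirnov]

lemma norm_smirnov_add_le_of_lt {n : ℕ} (hn : n ≠ 0) {P Q : ℂ[X]} (hP : P.natDegree = n)
    (hQ : Q = ∑ k ∈ Finset.range (n + 1), C ((starRingEnd ℂ) (P.coeff (n - k))) * X ^ k)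
    {a γ z : ℂ} (ha : ‖a‖ ≤ 1) {R : ℝ} (hR : 1 ≤ R) (hz : 1 ≤ ‖z‖)
    (hγ : ‖γ‖ < ((R + 1) / 2) ^ (n - 1)) :
    ‖smirnov n a P (R * z) + γ * smirnov n a P z‖ + ‖smirnov n a Q (R * z) + γ * smirnov n a Q z‖
      ≤ (‖(R : ℂ) ^ (n - 1) + γ‖ * (n * ‖z‖ ^ (n - 1)) + ‖1 + γ‖ * (n * ‖a‖)) * maxCircle P := by
  let F : ℂ[X] →ₗ[ℂ] ℂ := (leval (R * z) + γ • leval z) ∘ₗ smirnovPoly n a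
  have hFW : ∀ W, F W = smirnov n a W (R * z) + γ * smirnov n a W z := fun W => by
    simp [F, leval_apply, eval_smirnovPoly]
  have h := norm_map_add_norm_map_reciprocal_le (F := F) (fun W hW hroots h0 => ?_) hP hQ
  · rw [hFW, hFW, hFW, hFW, smirnov_X_pow, smirnov_X_pow, smirnov_one, smirnov_one] at h
    have e₁ : (n : ℂ) * (R * z) ^ (n - 1) + γ * (n * z ^ (n - 1))
        = ((R : ℂ) ^ (n - 1) + γ) * (n * z ^ (n - 1)) := by rw [mul_pow]; ring
    have e₂ : -((n : ℂ) * a) + γ * -(n * a) = -((1 + γ) * (n * a)) := by ring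
    rwa [e₁, e₂, norm_neg, norm_mul, norm_mul, norm_mul, norm_mul, norm_pow,
      Complex.norm_natCast] at h
  · rw [hFW] at h0
    have h₁ : ‖smirnov n a W (R * z)‖ = ‖γ‖ * ‖smirnov n a W z‖ := by
      rw [eq_neg_of_add_eq_zero_left h0, norm_neg, norm_mul]
    have h₂ := half_add_one_pow_mul_norm_smirnov_le hn ha hz hR hW hroots
    have h₃ := norm_pos_iff.2 (smirnov_ne_zero hn ha hz hW hroots)
    rw [h₁] at h₂
    exact (le_of_mul_le_mul_right h₂ h₃).not_gt hγ

lemma norm_smirnov_add_le {n : ℕ} (hn : n ≠ 0) {P Q : ℂ[X]} (hP : P.natDegree = n)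
    (hQ : Q = ∑ k ∈ Finset.range (n + 1), C ((starRingEnd ℂ) (P.coeff (n - k))) * X ^ k)
    {a γ z : ℂ} (ha : ‖a‖ ≤ 1) {R : ℝ} (hR : 1 ≤ R) (hz : 1 ≤ ‖z‖)
    (hγ : ‖γ‖ ≤ ((R + 1) / 2) ^ (n - 1)) :
    ‖smirnov n a P (R * z) + γ * smirnov n a P z‖ + ‖smirnov n a Q (R * z) + γ * smirnov n a Q z‖
      ≤ (‖(R : ℂ) ^ (n - 1) + γ‖ * (n * ‖z‖ ^ (n - 1)) + ‖1 + γ‖ * (n * ‖a‖)) * maxCircle P := by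
  have hk : 0 < ((R + 1) / 2) ^ (n - 1) := by positivity
  have hmem : γ ∈ closure (Metric.ball (0 : ℂ) (((R + 1) / 2) ^ (n - 1))) := by
    rw [closure_ball _ hk.ne']
    simpa using hγ
  refine closure_minimal (t := {γ : ℂ | ‖smirnov n a P (R * z) + γ * smirnov n a P z‖
    + ‖smirnov n a Q (R * z) + γ * smirnov n a Q z‖ ≤ (‖(R : ℂ) ^ (n - 1) + γ‖
      * (n * ‖z‖ ^ (n - 1)) + ‖1 + γ‖ * (n * ‖a‖)) * maxCircle P})
    (fun δ hδ => ?_) (isClosed_le (by fun_prop) (by fun_prop)) hmem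
  exact norm_smirnov_add_le_of_lt hn hP hQ ha hR hz (by simpa using hδ)

theorem statement4 (n : ℕ) (P Q : Polynomial ℂ) (hP : P.natDegree = n)
    (hQ : Q = ∑ k ∈ Finset.range (n + 1),
        Polynomial.C ((starRingEnd ℂ) (P.coeff (n - k))) * Polynomial.X ^ k)
    (a β : ℂ) (ha : ‖a‖ ≤ 1) (hβ : ‖β‖ ≤ 1)
    (R : ℝ) (hR : 1 ≤ R) (z : ℂ) (hz : 1 ≤ ‖z‖) :
    ‖smirnov n a P ((R : ℂ) * z) + β * ((((R + 1) / 2) ^ n : ℝ) : ℂ) * smirnov n a P z‖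
      + ‖smirnov n a Q ((R : ℂ) * z) + β * ((((R + 1) / 2) ^ n : ℝ) : ℂ) * smirnov n a Q z‖
      ≤ (‖(R : ℂ) ^ n + β * ((((R + 1) / 2) ^ n : ℝ) : ℂ)‖ * ((n : ℝ) * ‖z‖ ^ (n - 1))
          + ‖1 + β * ((((R + 1) / 2) ^ n : ℝ) : ℂ)‖ * ((n : ℝ) * ‖a‖))
        * maxCircle P := by
  have hM : 0 ≤ maxCircle P := (norm_nonneg _).trans (norm_eval_le_maxCircle P norm_one)
  obtain rfl | ⟨m, rfl⟩ : n = 0 ∨ ∃ m, n = m + 1 := by cases n <;> simp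
  · have hd : derivative P = 0 := derivative_of_natDegree_zero hP
    have hd' : derivative Q = 0 := by rw [hQ]; simp
    simp [smirnov, hd, hd']
  set γ : ℂ := β * ((((R + 1) / 2) ^ (m + 1) : ℝ) : ℂ) with hγdef
  have hγ : ‖γ‖ ≤ ((R + 1) / 2) ^ (m + 1) := by
    rw [hγdef, norm_mul, Complex.norm_of_nonneg (by positivity)]
    exact mul_le_of_le_one_left (by positivity) hβ
  obtain ⟨γ₀, hγ₀, h₁, h₂⟩ := exists_multiplier_split m hR hγ
  have hA := norm_smirnov_add_le m.succ_ne_zero hP hQ ha hR hz (γ := γ₀) (by simpa using hγ₀)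
  have hB := norm_smirnov_add_le m.succ_ne_zero hP hQ ha le_rfl hz (γ := 0) (by simp)
  simp only [Nat.succ_eq_add_one, Nat.add_sub_cancel, Complex.ofReal_one, one_mul, zero_mul,
    add_zero, one_pow, norm_one] at hA hB ⊢
  have hsplit : ∀ W : ℂ[X], ‖smirnov (m + 1) a W (R * z) + γ * smirnov (m + 1) a W z‖
      ≤ ‖smirnov (m + 1) a W (R * z) + γ₀ * smirnov (m + 1) a W z‖
        + ‖γ - γ₀‖ * ‖smirnov (m + 1) a W z‖ := fun W => by
    rw [← norm_mul]
    refine le_trans (le_of_eq ?_) (norm_add_le _ _)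
    congr 1
    ring
  set N : ℝ := ((m + 1 : ℕ) : ℝ) * ‖z‖ ^ m
  set K : ℝ := ((m + 1 : ℕ) : ℝ) * ‖a‖
  calc _ ≤ _ := add_le_add (hsplit P) (hsplit Q)
    _ = (‖smirnov (m + 1) a P (R * z) + γ₀ * smirnov (m + 1) a P z‖
          + ‖smirnov (m + 1) a Q (R * z) + γ₀ * smirnov (m + 1) a Q z‖)
        + ‖γ - γ₀‖ * (‖smirnov (m + 1) a P z‖ + ‖smirnov (m + 1) a Q z‖) := by ring
    _ ≤ (‖(R : ℂ) ^ m + γ₀‖ * N + ‖1 + γ₀‖ * K) * maxCircle P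
        + ‖γ - γ₀‖ * ((N + K) * maxCircle P) := by gcongr
    _ = ((‖(R : ℂ) ^ m + γ₀‖ + ‖γ - γ₀‖) * N + (‖1 + γ₀‖ + ‖γ - γ₀‖) * K)
        * maxCircle P := by ring
    _ ≤ _ := by gcongr
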